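/- Let k ≥ 3 and A_1, ..., A_k be positive integers with n = 1 + A_1 + ... + A_k, and suppose the A_i are mutually distinct and A_i < n/2 for every i. Set α_{ij} = (n - 1 - A_i - A_j)(A_j - A_i). Then the starlike tree S(A_1, A_2, ..., A_k) is transmission irregular if and only if there do not exist indices 1 ≤ i < j ≤ k for which α_{ij} has a positive divisor p ∈ ℕ with p > √|α_{ij}| satisfying: (i) n + 1 - 2·A_i ≤ p + α_{ij}/p ≤ n - 1; (ii) n + 1 - 2·A_j ≤ p - α_{ij}/p ≤ n - 1; (iii) p + α_{ij}/p ≡ n - 1 (mod 2). -/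

import Mathlib

/-- The transmission of a vertex: sum of distances to all other vertices. -/
noncomputable def transmission {V : Type*} [Fintype V] (G : SimpleGraph V) (u : V) : ℕ :=
  ∑ v : V, G.dist u v

/-- A graph is transmission irregular if all vertices have distinct transmissions. -/
def TransmissionIrregular {V : Type*} [Fintype V] (G : SimpleGraph V) : Prop :=
  Function.Injective (transmission G)

/-- The starlike tree `S(A 0, …, A (k-1))`: a central vertex (`none`) with `k`
pendent paths attached, the `i`-th of length `A i`; `some ⟨i, j⟩` is the
`(j+1)`-st vertex on the `i`-th pendent path. -/
def starlikeTree (k : ℕ) (A : Fin k → ℕ) :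
    SimpleGraph (Option ((i : Fin k) × Fin (A i))) :=
  SimpleGraph.fromRel (fun x y =>
    match x, y with
    | none, some ⟨_, j⟩ => j.val = 0
    | some ⟨i, j⟩, some ⟨i', j'⟩ => i.val = i'.val ∧ j.val + 1 = j'.val
    | _, _ => False)

/-- A function which vanishes only at `u`, is subadditive along edges, and decreases by one along
some edge out of every other vertex, is the distance from `u`. -/
theorem SimpleGraph.dist_eq_of_descent {V : Type*} (G : SimpleGraph V) (u : V) (f : V → ℕ)
    (hu : f u = 0) (hadj : ∀ v w, G.Adj v w → f w ≤ f v + 1)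
    (hdesc : ∀ v, v ≠ u → ∃ w, G.Adj w v ∧ f w + 1 = f v) (v : V) :
    G.dist u v = f v := by
  have lower : ∀ {a b : V} (p : G.Walk a b), f b ≤ f a + p.length := by
    intro a b p
    induction p with
    | nil => simp
    | cons h p ih =>
      have := hadj _ _ h
      rw [SimpleGraph.Walk.length_cons]
      omega
  have upper : ∀ m v, f v = m → ∃ p : G.Walk u v, p.length = m := by
    intro m
    induction m with
    | zero =>
      intro v hv
      by_cases h : v = u
      · subst h
        exact ⟨.nil, rfl⟩
      · obtain ⟨w, -, hw⟩ := hdesc v h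
        omega
    | succ m ih =>
      intro v hv
      obtain ⟨w, hwv, hw⟩ := hdesc v (by rintro rfl; omega)
      obtain ⟨p, hp⟩ := ih w (by omega)
      exact ⟨p.concat hwv, by simp [hp]⟩
  obtain ⟨p, hp⟩ := upper _ v rfl
  obtain ⟨q, hq⟩ := p.reachable.exists_walk_length_eq_dist
  have h₁ := SimpleGraph.dist_le p
  have h₂ := lower q
  omega

theorem starlikeTree_adj_none_some {k : ℕ} {A : Fin k → ℕ} {i : Fin k} {j : Fin (A i)} :
    (starlikeTree k A).Adj none (some ⟨i, j⟩) ↔ j.val = 0 := by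
  simp [starlikeTree]

theorem starlikeTree_adj_some_some {k : ℕ} {A : Fin k → ℕ} {i i' : Fin k} {j : Fin (A i)}
    {j' : Fin (A i')} :
    (starlikeTree k A).Adj (some ⟨i, j⟩) (some ⟨i', j'⟩) ↔
      i = i' ∧ (j.val + 1 = j'.val ∨ j'.val + 1 = j.val) := by
  simp only [starlikeTree, SimpleGraph.fromRel_adj, Fin.val_inj]
  constructor
  · rintro ⟨-, ⟨h, h'⟩ | ⟨h, h'⟩⟩
    · exact ⟨h, .inl h'⟩
    · exact ⟨h.symm, .inr h'⟩
  · rintro ⟨rfl, h⟩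
    refine ⟨?_, by simpa using h⟩
    intro he
    simp only [Option.some.injEq, Sigma.mk.injEq, heq_eq_eq, true_and] at he
    subst he
    omega

theorem starlikeTree_dist_none_some {k : ℕ} {A : Fin k → ℕ} (i : Fin k) (j : Fin (A i)) :
    (starlikeTree k A).dist none (some ⟨i, j⟩) = j.val + 1 := by
  refine SimpleGraph.dist_eq_of_descent _ none
    (fun v : Option ((i : Fin k) × Fin (A i)) => match v with
      | none => 0
      | some ⟨_, j⟩ => j.val + 1) rfl ?_ ?_ (some ⟨i, j⟩)
  · rintro (_ | ⟨a, b⟩) (_ | ⟨a', b'⟩) h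
    · simp
    · rw [starlikeTree_adj_none_some] at h
      simp [h]
    · simp
    · rw [starlikeTree_adj_some_some] at h
      simp only
      omega
  · rintro (_ | ⟨a, ⟨b, hb⟩⟩) h
    · exact absurd rfl h
    · rcases b with _ | b
      · exact ⟨none, starlikeTree_adj_none_some.2 rfl, rfl⟩
      · exact ⟨some ⟨a, ⟨b, by omega⟩⟩, starlikeTree_adj_some_some.2 ⟨rfl, .inl rfl⟩, rfl⟩

theorem starlikeTree_dist_some_some {k : ℕ} {A : Fin k → ℕ} (i : Fin k) (j : Fin (A i))
    (i' : Fin k) (j' : Fin (A i')) :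
    (starlikeTree k A).dist (some ⟨i, j⟩) (some ⟨i', j'⟩) =
      if i' = i then (j.val - j'.val) + (j'.val - j.val) else j.val + j'.val + 2 := by
  refine SimpleGraph.dist_eq_of_descent _ (some ⟨i, j⟩)
    (fun v : Option ((i : Fin k) × Fin (A i)) => match v with
      | none => j.val + 1
      | some ⟨i', j'⟩ =>
        if i' = i then (j.val - j'.val) + (j'.val - j.val) else j.val + j'.val + 2)
    (by simp) ?_ ?_ (some ⟨i', j'⟩)
  · rintro (_ | ⟨a, b⟩) (_ | ⟨a', b'⟩) h
    · simp
    · rw [starlikeTree_adj_none_some] at h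
      simp only
      split_ifs <;> omega
    · rw [SimpleGraph.adj_comm, starlikeTree_adj_none_some] at h
      simp only
      split_ifs <;> omega
    · rw [starlikeTree_adj_some_some] at h
      obtain ⟨rfl, h⟩ := h
      simp only
      split_ifs <;> omega
  · rintro (_ | ⟨a, ⟨b, hb⟩⟩) h
    · exact ⟨some ⟨i, ⟨0, by have := j.isLt; omega⟩⟩,
        (starlikeTree_adj_none_some.2 rfl).symm, by simp⟩
    · by_cases hai : a = i
      · subst hai
        have hne : b ≠ j.val := by
          rintro rfl
          exact h rfl
        rcases lt_or_gt_of_ne hne with hlt | hlt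
        · refine ⟨some ⟨a, ⟨b + 1, by have := j.isLt; omega⟩⟩,
            starlikeTree_adj_some_some.2 ⟨rfl, .inr rfl⟩, ?_⟩
          simp only [if_true]
          omega
        · refine ⟨some ⟨a, ⟨b - 1, by omega⟩⟩,
            starlikeTree_adj_some_some.2 ⟨rfl, .inl ?_⟩, ?_⟩
          · simp only
            omega
          · simp only [if_true]
            omega
      · rcases b with _ | b
        · exact ⟨none, starlikeTree_adj_none_some.2 rfl, by simp [hai]⟩
        · exact ⟨some ⟨a, ⟨b, by omega⟩⟩, starlikeTree_adj_some_some.2 ⟨rfl, .inl rfl⟩, by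
            simp only [if_neg hai]
            omega⟩

theorem two_mul_sum_range_min_succ {t m : ℕ} (h : t ≤ m) :
    2 * ∑ s ∈ Finset.range m, (min t (s + 1) : ℤ) = t * (2 * m + 1 - t) := by
  have small : ∀ l ≤ t, 2 * ∑ s ∈ Finset.range l, (min t (s + 1) : ℤ) = l * (l + 1) := by
    intro l hl
    induction l with
    | zero => simp
    | succ l ih =>
      rw [Finset.sum_range_succ, mul_add, ih (by omega), min_eq_right (by exact_mod_cast hl)]
      push_cast
      ring
  induction m, h using Nat.le_induction with
  | base =>
    rw [small t le_rfl]
    ring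
  | succ m hm ih =>
    rw [Finset.sum_range_succ, mul_add, ih, min_eq_left (by exact_mod_cast (by omega))]
    push_cast
    ring

/-- The vertex at distance `t = j + 1` from the centre on the `i`-th path exceeds the centre in
transmission by `t * (t + (n - 1 - 2 * A i))`. -/
theorem transmission_starlikeTree_some {k : ℕ} {A : Fin k → ℕ} {n : ℕ}
    (hn : n = 1 + ∑ i, A i) (i : Fin k) (j : Fin (A i)) :
    (transmission (starlikeTree k A) (some ⟨i, j⟩) : ℤ) =
      transmission (starlikeTree k A) none +
        ((j.val : ℤ) + 1) * ((j.val : ℤ) + 1 + ((n : ℤ) - 1 - 2 * A i)) := by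
  have hsome : ∀ (i' : Fin k) (j' : Fin (A i')),
      ((starlikeTree k A).dist (some ⟨i, j⟩) (some ⟨i', j'⟩) : ℤ) =
        ((j'.val : ℤ) + 1) + ((j.val : ℤ) + 1) -
          if i' = i then 2 * min (((j.val + 1 : ℕ) : ℤ)) ((j'.val : ℤ) + 1) else 0 := by
    intro i' j'
    rw [starlikeTree_dist_some_some]
    split_ifs <;> push_cast <;> omega
  have hmin := two_mul_sum_range_min_succ (Nat.succ_le_of_lt j.isLt)
  rw [← Fin.sum_univ_eq_sum_range (fun s => (min ((j.val + 1 : ℕ) : ℤ) ((s : ℤ) + 1)))] at hmin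
  have hbranch : ∀ i', (∑ j' : Fin (A i'),
      if i' = i then 2 * min (((j.val + 1 : ℕ) : ℤ)) ((j'.val : ℤ) + 1) else 0) =
      if i' = i then ((j.val : ℤ) + 1) * (2 * A i + 1 - (j.val + 1)) else 0 := by
    intro i'
    split_ifs with h
    · subst h
      rw [← Finset.mul_sum]
      exact_mod_cast hmin
    · simp
  simp only [transmission, Fintype.sum_option, Fintype.sum_sigma, SimpleGraph.dist_self,
    SimpleGraph.dist_comm (v := none) (u := some _), starlikeTree_dist_none_some]
  push_cast
  simp only [hsome, Finset.sum_sub_distrib, Finset.sum_add_distrib, hbranch, Finset.sum_ite_eq',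
    Finset.mem_univ, if_true, Finset.sum_const, Finset.card_univ, Fintype.card_fin, nsmul_eq_mul,
    ← Finset.sum_mul]
  subst hn
  push_cast
  ring

/-- Completing the square turns a coincidence `t * (t + c) = s * (s + d)` with `c ≡ d [ZMOD 2]`
into a factorization of `(c ^ 2 - d ^ 2) / 4`. -/
theorem exists_pos_mul_eq_iff_divisor {N a b α : ℤ} (ha : 2 * a ≤ N) (hb : 2 * b ≤ N)
    (hα : α = (N - a - b) * (b - a)) :
    (∃ t s : ℤ, (1 ≤ t ∧ t ≤ a) ∧ (1 ≤ s ∧ s ≤ b) ∧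
        t * (t + (N - 2 * a)) = s * (s + (N - 2 * b))) ↔
      ∃ p : ℤ, 0 < p ∧ p ∣ α ∧ Real.sqrt |(α : ℝ)| < (p : ℝ) ∧
        (N + 2 - 2 * a ≤ p + α / p ∧ p + α / p ≤ N) ∧
        (N + 2 - 2 * b ≤ p - α / p ∧ p - α / p ≤ N) ∧ p + α / p ≡ N [ZMOD 2] := by
  constructor
  · rintro ⟨t, s, ht, hs, h⟩
    have hmul : α = (t + s + (N - a - b)) * (t - s + (b - a)) := by
      rw [hα]
      linear_combination -h
    have hpos : 0 < t + s + (N - a - b) := by omega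
    have hdiv : α / (t + s + (N - a - b)) = t - s + (b - a) := by
      rw [hmul, Int.mul_ediv_cancel_left _ hpos.ne']
    refine ⟨t + s + (N - a - b), hpos, ⟨_, hmul⟩, ?_, ?_, ?_, ?_⟩
    · rw [Real.sqrt_lt' (by exact_mod_cast hpos)]
      have : |α| < (t + s + (N - a - b)) ^ 2 := by
        rw [hmul, abs_mul, abs_of_pos hpos, sq]
        exact mul_lt_mul_of_pos_left (abs_lt.2 ⟨by omega, by omega⟩) hpos
      exact_mod_cast this
    · rw [hdiv]
      omega
    · rw [hdiv]
      omega
    · rw [hdiv, Int.ModEq]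
      omega
  · rintro ⟨p, hp, ⟨q, rfl⟩, -, h₁, h₂, h₃⟩
    rw [Int.mul_ediv_cancel_left _ hp.ne'] at h₁ h₂ h₃
    rw [Int.ModEq] at h₃
    obtain ⟨t, ht⟩ : ∃ t, p + q = 2 * t + (N - 2 * a) := ⟨(p + q - N + 2 * a) / 2, by omega⟩
    obtain ⟨s, hs⟩ : ∃ s, p - q = 2 * s + (N - 2 * b) := ⟨(p - q - N + 2 * b) / 2, by omega⟩
    refine ⟨t, s, by omega, by omega, ?_⟩
    obtain rfl : p = t + s + (N - a - b) := by omega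
    obtain rfl : q = t - s + (b - a) := by omega
    linear_combination hα

/-- Assuming the branch lengths are mutually distinct and each is less than `n/2`,
the starlike tree `S(A₁, …, A_k)` is transmission irregular if and only if no
`α_{ij}` (for `i < j`) has a positive divisor `p > √|α_{ij}|` satisfying the
three stated conditions. -/
theorem starlike_TI_iff_no_divisor (k : ℕ) (hk : 3 ≤ k)
    (A : Fin k → ℕ) (hA : ∀ i, 0 < A i) (n : ℕ) (hn : n = 1 + ∑ i, A i)
    (hdist : Function.Injective A) (hhalf : ∀ i, 2 * A i < n)
    (α : Fin k → Fin k → ℤ)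
    (hα : ∀ i j, α i j = ((n : ℤ) - 1 - (A i : ℤ) - (A j : ℤ)) * ((A j : ℤ) - (A i : ℤ))) :
    TransmissionIrregular (starlikeTree k A) ↔
      ¬ ∃ i j : Fin k, i < j ∧ ∃ p : ℤ, 0 < p ∧ p ∣ α i j ∧
        Real.sqrt |((α i j : ℤ) : ℝ)| < (p : ℝ) ∧
        ((n : ℤ) + 1 - 2 * (A i : ℤ) ≤ p + α i j / p ∧ p + α i j / p ≤ (n : ℤ) - 1) ∧
        ((n : ℤ) + 1 - 2 * (A j : ℤ) ≤ p - α i j / p ∧ p - α i j / p ≤ (n : ℤ) - 1) ∧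
        p + α i j / p ≡ (n : ℤ) - 1 [ZMOD 2] := by
  have htr := transmission_starlikeTree_some hn
  have hcollision : ∀ i j : Fin k,
      (∃ (x : Fin (A i)) (y : Fin (A j)), transmission (starlikeTree k A) (some ⟨i, x⟩) =
          transmission (starlikeTree k A) (some ⟨j, y⟩)) ↔
        ∃ p : ℤ, 0 < p ∧ p ∣ α i j ∧
          Real.sqrt |((α i j : ℤ) : ℝ)| < (p : ℝ) ∧
          ((n : ℤ) + 1 - 2 * (A i : ℤ) ≤ p + α i j / p ∧ p + α i j / p ≤ (n : ℤ) - 1) ∧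
          ((n : ℤ) + 1 - 2 * (A j : ℤ) ≤ p - α i j / p ∧ p - α i j / p ≤ (n : ℤ) - 1) ∧
          p + α i j / p ≡ (n : ℤ) - 1 [ZMOD 2] := by
    intro i j
    have hi := hhalf i
    have hj := hhalf j
    have key := exists_pos_mul_eq_iff_divisor (N := (n : ℤ) - 1) (by omega) (by omega) (hα i j)
    rw [show (n : ℤ) - 1 + 2 = n + 1 by ring] at key
    rw [← key]
    constructor
    · rintro ⟨x, y, hxy⟩
      have hx := htr i x
      rw [hxy, htr j y] at hx
      exact ⟨x + 1, y + 1, by omega, by omega, (add_left_cancel hx).symm⟩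
    · rintro ⟨t, s, ht, hs, h⟩
      refine ⟨⟨(t - 1).toNat, by omega⟩, ⟨(s - 1).toNat, by omega⟩, ?_⟩
      zify
      rw [htr, htr]
      have h₁ : ((t - 1).toNat : ℤ) + 1 = t := by omega
      have h₂ : ((s - 1).toNat : ℤ) + 1 = s := by omega
      simp only [h₁, h₂, h]
  have hcentre : ∀ (i : Fin k) (x : Fin (A i)), transmission (starlikeTree k A) (some ⟨i, x⟩) ≠
      transmission (starlikeTree k A) none := by
    intro i x hx
    have h := htr i x
    have hi := hhalf i
    rw [hx] at h
    have : 0 < ((x : ℤ) + 1) * ((x : ℤ) + 1 + ((n : ℤ) - 1 - 2 * A i)) :=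
      mul_pos (by omega) (by omega)
    omega
  constructor
  · rintro hinj ⟨i, j, hij, hp⟩
    obtain ⟨x, y, hxy⟩ := (hcollision i j).2 hp
    have := hinj hxy
    simp only [Option.some.injEq, Sigma.mk.injEq] at this
    exact hij.ne this.1
  · intro hno
    rintro (_ | ⟨i, x⟩) (_ | ⟨j, y⟩) hxy
    · rfl
    · exact absurd hxy.symm (hcentre j y)
    · exact absurd hxy (hcentre i x)
    · rcases lt_trichotomy i j with hij | rfl | hij
      · exact absurd ⟨i, j, hij, (hcollision i j).1 ⟨x, y, hxy⟩⟩ hno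
      · have h := htr i x
        have hi := hhalf i
        rw [hxy, htr i y] at h
        have hfac : ((y : ℤ) - x) * ((y : ℤ) + x + 2 + ((n : ℤ) - 1 - 2 * A i)) = 0 := by
          linear_combination h
        rcases mul_eq_zero.1 hfac with h₀ | h₀
        · obtain rfl : x = y := Fin.ext (by omega)
          rfl
        · omega
      · exact absurd ⟨j, i, hij, (hcollision j i).1 ⟨y, x, hxy.symm⟩⟩ hno
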